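/- Let V : ℝ^d → ℝ be convex and twice continuously differentiable with ∫ e^{−V(x)} dx < ∞, and let μ be the probability measure on ℝ^d with density proportional to e^{−V}. Then for every t > 0 and every x ∈ ℝ^d: −(1/(1−e^{−2t})) I_d ⪯ ∇²log p_t(x) ⪯ 0 in the Loewner order; consequently the relative score x ↦ ∇log p_t(x) + x is Lipschitz with constant 1/(1−e^{−2t}). (In particular, the time-varying smoothness assumption holds with β̃₀ = 1 for log-concave data distributions.) -/

import Mathlib

open MeasureTheory Real
open scoped RealInnerProductSpace ENNReal Classical

noncomputable section

/-- `Euc d` is Euclidean space `ℝ^d`. -/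
abbrev Euc (d : ℕ) := EuclideanSpace ℝ (Fin d)

/-- The standard Gaussian measure `N(0, I_d)` on `ℝ^d`. -/
def stdGaussian (d : ℕ) : Measure (Euc d) :=
  volume.withDensity fun x =>
    ENNReal.ofReal ((2 * π) ^ (-(d : ℝ) / 2) * Real.exp (-‖x‖ ^ 2 / 2))

/-- The density `p_t` of the Ornstein–Uhlenbeck flow of `μ` at time `t`. -/
def ouDensity (d : ℕ) (μ : Measure (Euc d)) (t : ℝ) (x : Euc d) : ℝ :=
  (2 * π * (1 - Real.exp (-2 * t))) ^ (-(d : ℝ) / 2) *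
    ∫ y, Real.exp (-‖x - Real.exp (-t) • y‖ ^ 2 / (2 * (1 - Real.exp (-2 * t)))) ∂μ

/-- The Ornstein–Uhlenbeck flow `μ_t` of `μ` at time `t`, i.e. the measure with
density `p_t` with respect to Lebesgue measure. -/
def ouFlow (d : ℕ) (μ : Measure (Euc d)) (t : ℝ) : Measure (Euc d) :=
  volume.withDensity fun x => ENNReal.ofReal (ouDensity d μ t x)

/-- The relative score `x ↦ ∇ log p_t(x) + x` of `μ_t`. -/
def relScore (d : ℕ) (μ : Measure (Euc d)) (t : ℝ) (x : Euc d) : Euc d :=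
  gradient (fun z => Real.log (ouDensity d μ t z)) x + x

/-- The relative Fisher information `FI(μ_t ‖ γ_d) = ∫ ‖∇ log p_t + x‖² dμ_t`. -/
def relFisher (d : ℕ) (μ : Measure (Euc d)) (t : ℝ) : ℝ :=
  ∫ x, ‖relScore d μ t x‖ ^ 2 ∂(ouFlow d μ t)

/-- Kullback–Leibler divergence `KL(ρ ‖ σ)`. -/
def KLdiv {α : Type*} [MeasurableSpace α] (ρ σ : Measure α) : ℝ≥0∞ :=
  if ρ ≪ σ then ENNReal.ofReal (∫ x, Real.log ((ρ.rnDeriv σ x).toReal) ∂ρ) else ⊤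

theorem volume_add_le_of_isCompact {K L C : Set ℝ} (hK : IsCompact K) (hL : IsCompact L)
    (hK' : K.Nonempty) (hL' : L.Nonempty) (h : ∀ x ∈ K, ∀ y ∈ L, x + y ∈ C) :
    volume K + volume L ≤ volume C := by
  have h1 : volume ((fun x => x + sInf L) '' K) = volume K := by
    simp
  have h2 : volume ((fun x => sSup K + x) '' L) = volume L := by
    simp
  have hmeas : MeasurableSet ((fun x => sSup K + x) '' L) :=
    (hL.image (by fun_prop)).measurableSet
  have hinter : volume (((fun x => x + sInf L) '' K) ∩ ((fun x => sSup K + x) '' L)) = 0 := by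
    refine measure_mono_null (t := {sSup K + sInf L}) ?_ (by simp)
    rintro _ ⟨⟨x, hx, rfl⟩, ⟨y, hy, hxy⟩⟩
    have h3 := le_csSup hK.bddAbove hx
    have h4 := csInf_le hL.bddBelow hy
    simp only [Set.mem_singleton_iff] at hxy ⊢
    linarith
  rw [← h1, ← h2, ← measure_union_add_inter _ hmeas, hinter, add_zero]
  apply measure_mono
  rintro _ (⟨x, hx, rfl⟩ | ⟨y, hy, rfl⟩)
  · exact h _ hx _ (hL.sInf_mem hL')
  · exact h _ (hK.sSup_mem hK') _ hy

/-- The Brunn-Minkowski inequality on the real line. -/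
theorem volume_add_le_of_forall_add_mem {A B C : Set ℝ} (hA : MeasurableSet A)
    (hB : MeasurableSet B) (hA' : A.Nonempty) (hB' : B.Nonempty)
    (h : ∀ x ∈ A, ∀ y ∈ B, x + y ∈ C) :
    volume A + volume B ≤ volume C := by
  obtain ⟨a, ha⟩ := hA'
  obtain ⟨b, hb⟩ := hB'
  have key : ∀ K ⊆ A, IsCompact K → ∀ L ⊆ B, IsCompact L → volume K + volume L ≤ volume C := by
    intro K hKA hK L hLB hL
    have := volume_add_le_of_isCompact (hK.insert a) (hL.insert b) (Set.insert_nonempty _ _)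
      (Set.insert_nonempty _ _) (C := C) fun x hx y hy =>
        h x (Set.insert_subset ha hKA hx) y (Set.insert_subset hb hLB hy)
    exact le_trans (add_le_add (measure_mono (Set.subset_insert _ _))
      (measure_mono (Set.subset_insert _ _))) this
  rw [hA.measure_eq_iSup_isCompact, hB.measure_eq_iSup_isCompact]
  simp only [iSup_and']
  refine ENNReal.biSup_add_biSup_le' ⟨∅, by simp⟩ ⟨∅, by simp⟩ ?_
  intro K hK L hL
  exact key K hK.1 hK.2 L hL.1 hL.2

theorem lintegral_eq_lintegral_meas_lt_of_le_one {α : Type*} [MeasurableSpace α] (μ : Measure α)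
    {f : α → ℝ≥0∞} (hf : Measurable f) (hf1 : ∀ x, f x ≤ 1) :
    ∫⁻ x, f x ∂μ = ∫⁻ t in Set.Ioi (0 : ℝ), μ {x | ENNReal.ofReal t < f x} := by
  have hne : ∀ x, f x ≠ ∞ := fun x => ne_top_of_le_ne_top ENNReal.one_ne_top (hf1 x)
  have h := lintegral_eq_lintegral_meas_lt μ (f := fun x => (f x).toReal)
    (Filter.Eventually.of_forall fun x => ENNReal.toReal_nonneg) hf.ennreal_toReal.aemeasurable
  simp only [ENNReal.ofReal_toReal (hne _)] at h
  rw [h]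
  refine setLIntegral_congr_fun measurableSet_Ioi fun t ht => ?_
  simp only [ENNReal.ofReal_lt_iff_lt_toReal (le_of_lt ht) (hne _)]

theorem ENNReal.geom_mean_le_arith_mean_two {a b : ℝ} (ha : 0 < a) (hb : 0 < b) (hab : a + b = 1)
    (x y : ℝ≥0∞) : x ^ a * y ^ b ≤ ENNReal.ofReal a * x + ENNReal.ofReal b * y := by
  have hpq : (a⁻¹).HolderConjugate b⁻¹ := by
    rw [Real.holderConjugate_iff]
    refine ⟨(one_lt_inv₀ ha).2 (by linarith), by simpa using hab⟩
  have h := ENNReal.young_inequality (x ^ a) (y ^ b) hpq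
  rwa [← ENNReal.rpow_mul, ← ENNReal.rpow_mul, mul_inv_cancel₀ ha.ne', mul_inv_cancel₀ hb.ne',
    ENNReal.rpow_one, ENNReal.rpow_one, ENNReal.ofReal_inv_of_pos ha, ENNReal.ofReal_inv_of_pos hb,
    div_eq_mul_inv, div_eq_mul_inv, inv_inv, inv_inv, mul_comm x, mul_comm y] at h

/-- A one-dimensional Prékopa-Leindler inequality for functions with essential supremum one. -/
theorem lintegral_add_le_of_le_one {a b : ℝ} (ha : 0 < a) (hb : 0 < b) (hab : a + b = 1)
    {f g h : ℝ → ℝ≥0∞} (hf : Measurable f) (hg : Measurable g) (hh : Measurable h)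
    (hf1 : ∀ x, f x ≤ 1) (hg1 : ∀ x, g x ≤ 1)
    (hf' : ∀ t < 1, ∃ x, t < f x) (hg' : ∀ t < 1, ∃ x, t < g x)
    (hfg : ∀ x y, f x ^ a * g y ^ b ≤ h (a * x + b * y)) :
    ENNReal.ofReal a * (∫⁻ x, f x) + ENNReal.ofReal b * (∫⁻ x, g x) ≤ ∫⁻ x, h x := by
  have hmin : ∫⁻ x, min (h x) 1 ≤ ∫⁻ x, h x := lintegral_mono fun x => min_le_left _ _
  refine le_trans ?_ hmin
  rw [lintegral_eq_lintegral_meas_lt_of_le_one _ hf hf1,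
    lintegral_eq_lintegral_meas_lt_of_le_one _ hg hg1,
    lintegral_eq_lintegral_meas_lt_of_le_one _ (hh.min measurable_const) fun x => min_le_right _ _,
    ← lintegral_const_mul' _ _ ENNReal.ofReal_ne_top,
    ← lintegral_const_mul' _ _ ENNReal.ofReal_ne_top, ← lintegral_add_left']
  swap
  · refine (Antitone.measurable fun s t hst => ?_).aemeasurable
    refine mul_le_mul_right ?_ _
    exact measure_mono fun x (hx : _ < _) => lt_of_le_of_lt (ENNReal.ofReal_le_ofReal hst) hx
  refine setLIntegral_mono' measurableSet_Ioi fun t ht => ?_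
  have ht0 : (0 : ℝ) < t := ht
  rcases le_or_gt 1 (ENNReal.ofReal t) with h1 | h1
  · have e1 : {x | ENNReal.ofReal t < f x} = ∅ :=
      Set.eq_empty_of_forall_notMem fun x hx => absurd ((hf1 x).trans h1) (not_le.2 hx)
    have e2 : {x | ENNReal.ofReal t < g x} = ∅ :=
      Set.eq_empty_of_forall_notMem fun x hx => absurd ((hg1 x).trans h1) (not_le.2 hx)
    simp [e1, e2]
  have hA : MeasurableSet {x | ENNReal.ofReal t < f x} := measurableSet_lt measurable_const hf
  have hB : MeasurableSet {x | ENNReal.ofReal t < g x} := measurableSet_lt measurable_const hg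
  have e1 := Measure.addHaar_smul volume a {x | ENNReal.ofReal t < f x}
  have e2 := Measure.addHaar_smul volume b {x | ENNReal.ofReal t < g x}
  rw [Module.finrank_self, pow_one, abs_of_pos ha] at e1
  rw [Module.finrank_self, pow_one, abs_of_pos hb] at e2
  rw [← e1, ← e2]
  refine volume_add_le_of_forall_add_mem (hA.const_smul₀ a) (hB.const_smul₀ b)
    (Set.Nonempty.smul_set (hf' _ h1)) (Set.Nonempty.smul_set (hg' _ h1)) ?_
  rintro _ ⟨x, hx, rfl⟩ _ ⟨y, hy, rfl⟩
  simp only [Set.mem_ofPred_eq, smul_eq_mul, lt_min_iff] at *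
  refine ⟨lt_of_lt_of_le ?_ (hfg x y), h1⟩
  calc ENNReal.ofReal t = ENNReal.ofReal t ^ a * ENNReal.ofReal t ^ b := by
        rw [← ENNReal.rpow_add _ _ (by simpa using ht0) ENNReal.ofReal_ne_top, hab,
          ENNReal.rpow_one]
    _ < f x ^ a * g y ^ b :=
        ENNReal.mul_lt_mul (ENNReal.rpow_lt_rpow hx ha) (ENNReal.rpow_lt_rpow hy hb)

theorem prekopa_leindler_real_of_bounded {a b : ℝ} (ha : 0 < a) (hb : 0 < b) (hab : a + b = 1)
    {f g h : ℝ → ℝ≥0∞} (hf : Measurable f) (hg : Measurable g) (hh : Measurable h)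
    {M : ℝ≥0∞} (hM : M ≠ ∞) (hfM : ∀ x, f x ≤ M) (hgM : ∀ x, g x ≤ M)
    (hfg : ∀ x y, f x ^ a * g y ^ b ≤ h (a * x + b * y)) :
    (∫⁻ x, f x) ^ a * (∫⁻ x, g x) ^ b ≤ ∫⁻ x, h x := by
  set A := ⨆ x, f x with hA
  set B := ⨆ x, g x with hB
  have hAt : A ≠ ∞ := ne_top_of_le_ne_top hM (iSup_le hfM)
  have hBt : B ≠ ∞ := ne_top_of_le_ne_top hM (iSup_le hgM)
  by_cases hA0 : A = 0
  · have : ∀ x, f x = 0 := by simpa [hA] using hA0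
    simp [this, ENNReal.zero_rpow_of_pos ha]
  by_cases hB0 : B = 0
  · have : ∀ x, g x = 0 := by simpa [hB] using hB0
    simp [this, ENNReal.zero_rpow_of_pos hb]
  have hC0 : A ^ a * B ^ b ≠ 0 :=
    mul_ne_zero (ENNReal.rpow_pos (pos_iff_ne_zero.2 hA0) hAt).ne'
      (ENNReal.rpow_pos (pos_iff_ne_zero.2 hB0) hBt).ne'
  have hCt : A ^ a * B ^ b ≠ ∞ :=
    ENNReal.mul_ne_top (ENNReal.rpow_ne_top_of_nonneg ha.le hAt)
      (ENNReal.rpow_ne_top_of_nonneg hb.le hBt)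
  have norm_eq : ∀ u v : ℝ≥0∞, (u / A) ^ a * (v / B) ^ b = (u ^ a * v ^ b) / (A ^ a * B ^ b) := by
    intro u v
    rw [ENNReal.div_rpow_of_nonneg _ _ ha.le, ENNReal.div_rpow_of_nonneg _ _ hb.le,
      ENNReal.mul_div_mul_comm]
    · exact Or.inl (ENNReal.rpow_pos (pos_iff_ne_zero.2 hA0) hAt).ne'
    · exact Or.inl (ENNReal.rpow_ne_top_of_nonneg ha.le hAt)
  have sup_lt : ∀ (u : ℝ → ℝ≥0∞), (⨆ x, u x) ≠ 0 → (⨆ x, u x) ≠ ∞ → ∀ t < 1,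
      ∃ x, t < u x / ⨆ x, u x := by
    intro u h0 h1 t ht
    have : t * (⨆ x, u x) < ⨆ x, u x := by
      conv_rhs => rw [← one_mul (⨆ x, u x)]
      exact ENNReal.mul_lt_mul_left h0 h1 ht
    obtain ⟨x, hx⟩ := lt_iSup_iff.1 this
    exact ⟨x, (ENNReal.lt_div_iff_mul_lt (Or.inl h0) (Or.inl h1)).2 hx⟩
  have key := lintegral_add_le_of_le_one ha hb hab (hf.div_const A) (hg.div_const B)
    (hh.div_const (A ^ a * B ^ b))
    (fun x => ENNReal.div_le_of_le_mul (by simpa using le_iSup f x))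
    (fun x => ENNReal.div_le_of_le_mul (by simpa using le_iSup g x))
    (sup_lt f hA0 hAt) (sup_lt g hB0 hBt)
    (fun x y => by rw [norm_eq]; exact ENNReal.div_le_div_right (hfg x y) _)
  have := (ENNReal.geom_mean_le_arith_mean_two ha hb hab _ _).trans key
  simp only [div_eq_mul_inv] at this norm_eq
  rw [lintegral_mul_const _ hf, lintegral_mul_const _ hg, lintegral_mul_const _ hh, norm_eq] at this
  exact (ENNReal.mul_le_mul_iff_left (ENNReal.inv_ne_zero.2 hCt) (ENNReal.inv_ne_top.2 hC0)).1 this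

/-- The one-dimensional Prékopa-Leindler inequality. -/
theorem prekopa_leindler_real {a b : ℝ} (ha : 0 < a) (hb : 0 < b) (hab : a + b = 1)
    {f g h : ℝ → ℝ≥0∞} (hf : Measurable f) (hg : Measurable g) (hh : Measurable h)
    (hfg : ∀ x y, f x ^ a * g y ^ b ≤ h (a * x + b * y)) :
    (∫⁻ x, f x) ^ a * (∫⁻ x, g x) ^ b ≤ ∫⁻ x, h x := by
  have trunc : ∀ u : ℝ → ℝ≥0∞, Measurable u → ∀ c : ℝ, 0 < c →
      (∫⁻ x, u x) ^ c = ⨆ n : ℕ, (∫⁻ x, min (u x) n) ^ c := by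
    intro u hu c hc
    have h1 : ∀ x, u x = ⨆ n : ℕ, min (u x) n := by
      intro x
      rw [← inf_iSup_eq, ENNReal.iSup_natCast, inf_top_eq]
    have h2 : ∫⁻ x, u x = ⨆ n : ℕ, ∫⁻ x, min (u x) n := by
      conv_lhs => enter [2, x]; rw [h1 x]
      exact lintegral_iSup (fun n => hu.min measurable_const)
        fun m n hmn x => min_le_min_left _ (by exact_mod_cast hmn)
    rw [h2]
    exact (ENNReal.orderIsoRpow c hc).map_iSup _
  rw [trunc f hf a ha, trunc g hg b hb, ENNReal.iSup_mul]
  refine iSup_le fun m => ?_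
  rw [ENNReal.mul_iSup]
  refine iSup_le fun n => ?_
  refine prekopa_leindler_real_of_bounded ha hb hab (hf.min measurable_const)
    (hg.min measurable_const) hh (ENNReal.natCast_ne_top (max m n))
    (fun x => (min_le_right _ _).trans (by exact_mod_cast le_max_left m n))
    (fun x => (min_le_right _ _).trans (by exact_mod_cast le_max_right m n))
    fun x y => le_trans ?_ (hfg x y)
  exact mul_le_mul' (ENNReal.rpow_le_rpow (min_le_left _ _) ha.le)
    (ENNReal.rpow_le_rpow (min_le_left _ _) hb.le)

/-- The Prékopa-Leindler inequality on a finite power of the real line. -/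
theorem prekopa_leindler_pi {a b : ℝ} (ha : 0 < a) (hb : 0 < b) (hab : a + b = 1) (n : ℕ)
    {f g h : (Fin n → ℝ) → ℝ≥0∞} (hf : Measurable f) (hg : Measurable g) (hh : Measurable h)
    (hfg : ∀ x y, f x ^ a * g y ^ b ≤ h (a • x + b • y)) :
    (∫⁻ x, f x) ^ a * (∫⁻ x, g x) ^ b ≤ ∫⁻ x, h x := by
  induction n with
  | zero =>
    have h0 := (hfg default default).trans_eq (congrArg h (Subsingleton.elim _ default))
    rw [lintegral_unique, lintegral_unique, lintegral_unique, volume_pi, Measure.pi_of_empty]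
    simp only [measure_univ, mul_one]
    convert h0
  | succ n ih =>
    let e := MeasurableEquiv.piFinSuccAbove (fun _ : Fin (n + 1) => ℝ) 0
    have he : MeasurePreserving e.symm volume volume :=
      (volume_preserving_piFinSuccAbove (fun _ : Fin (n + 1) => ℝ) 0).symm
    have lintegral_eq : ∀ u : (Fin (n + 1) → ℝ) → ℝ≥0∞, Measurable u →
        ∫⁻ x, u x = ∫⁻ s : ℝ, ∫⁻ z : Fin n → ℝ, u (e.symm (s, z)) := by
      intro u hu
      rw [← he.lintegral_comp hu]
      exact lintegral_prod _ (hu.comp e.symm.measurable).aemeasurable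
    have meas : ∀ u : (Fin (n + 1) → ℝ) → ℝ≥0∞, Measurable u →
        Measurable fun s : ℝ => ∫⁻ z : Fin n → ℝ, u (e.symm (s, z)) := fun u hu =>
      (hu.comp e.symm.measurable).lintegral_prod_right'
    have e_add : ∀ (s r : ℝ) (z w : Fin n → ℝ), a • e.symm (s, z) + b • e.symm (r, w) =
        e.symm (a * s + b * r, a • z + b • w) := by
      intro s r z w
      ext i
      refine Fin.cases ?_ (fun j => ?_) i <;> simp [e, MeasurableEquiv.piFinSuccAbove]
    rw [lintegral_eq f hf, lintegral_eq g hg, lintegral_eq h hh]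
    refine prekopa_leindler_real ha hb hab (meas f hf) (meas g hg) (meas h hh) fun s r => ?_
    refine ih (hf.comp (e.symm.measurable.comp measurable_prodMk_left))
      (hg.comp (e.symm.measurable.comp measurable_prodMk_left))
      (hh.comp (e.symm.measurable.comp measurable_prodMk_left)) fun z w => ?_
    simpa only [Function.comp_apply, e_add] using hfg (e.symm (s, z)) (e.symm (r, w))

/-- The Prékopa-Leindler inequality on Euclidean space. -/
theorem prekopa_leindler {a b : ℝ} (ha : 0 < a) (hb : 0 < b) (hab : a + b = 1) {n : ℕ}
    {f g h : EuclideanSpace ℝ (Fin n) → ℝ≥0∞} (hf : Measurable f) (hg : Measurable g)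
    (hh : Measurable h) (hfg : ∀ x y, f x ^ a * g y ^ b ≤ h (a • x + b • y)) :
    (∫⁻ x, f x) ^ a * (∫⁻ x, g x) ^ b ≤ ∫⁻ x, h x := by
  have he := PiLp.volume_preserving_toLp (Fin n)
  have hm : Measurable (WithLp.toLp 2 : (Fin n → ℝ) → EuclideanSpace ℝ (Fin n)) := he.measurable
  rw [← he.lintegral_comp hf, ← he.lintegral_comp hg, ← he.lintegral_comp hh]
  exact prekopa_leindler_pi ha hb hab n (hf.comp hm) (hg.comp hm) (hh.comp hm)
    fun x y => hfg _ _

section Hessian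
variable {E : Type*} [NormedAddCommGroup E] [InnerProductSpace ℝ E]

/-- The real inner product as a continuous bilinear map. -/
def realInnerCLM (E : Type*) [NormedAddCommGroup E] [InnerProductSpace ℝ E] :
    E →L[ℝ] E →L[ℝ] ℝ :=
  (innerₗ E).mkContinuous₂ 1 fun x y => by simpa using norm_inner_le_norm (𝕜 := ℝ) x y

@[simp]
theorem realInnerCLM_apply (x y : E) : realInnerCLM E x y = ⟪x, y⟫ := rfl

theorem norm_realInnerCLM_le : ‖realInnerCLM E‖ ≤ 1 :=
  LinearMap.mkContinuous₂_norm_le _ zero_le_one _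

theorem norm_realInnerCLM_apply_le (x : E) : ‖realInnerCLM E x‖ ≤ ‖x‖ :=
  (realInnerCLM E).le_of_opNorm_le_of_le norm_realInnerCLM_le le_rfl |>.trans_eq (one_mul _)

theorem norm_sq_convex_combination {α β : ℝ} (hαβ : α + β = 1) (x y : E) :
    ‖α • x + β • y‖ ^ 2 = α * ‖x‖ ^ 2 + β * ‖y‖ ^ 2 - α * β * ‖x - y‖ ^ 2 := by
  rw [norm_add_sq_real, norm_sub_sq_real, norm_smul, norm_smul, inner_smul_left, inner_smul_right,
    mul_pow, mul_pow, Real.norm_eq_abs, Real.norm_eq_abs, sq_abs, sq_abs]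
  obtain rfl : β = 1 - α := by linarith
  simp only [conj_trivial]
  ring

theorem ConvexOn.second_fderiv_nonneg {g : E → ℝ} {g' : E → E →L[ℝ] ℝ} {g'' : E →L[ℝ] E →L[ℝ] ℝ}
    {x : E} (hg : ConvexOn ℝ Set.univ g) (h1 : ∀ z, HasFDerivAt g (g' z) z)
    (h2 : HasFDerivAt g' g'' x) (u : E) : 0 ≤ g'' u u := by
  have hline : ∀ r : ℝ, HasDerivAt (fun r : ℝ => x + r • u) u r := fun r => by
    simpa using ((hasDerivAt_id r).smul_const u).const_add x
  have hd1 : ∀ r : ℝ, HasDerivAt (fun r : ℝ => g (x + r • u)) (g' (x + r • u) u) r := fun r =>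
    (h1 (x + r • u)).comp_hasDerivAt r (hline r)
  have hconv : ConvexOn ℝ Set.univ fun r : ℝ => g (x + r • u) := by
    refine ⟨convex_univ, fun r _ s _ α β hα hβ hαβ => ?_⟩
    have := hg.2 (Set.mem_univ (x + r • u)) (Set.mem_univ (x + s • u)) hα hβ hαβ
    refine le_trans (le_of_eq ?_) this
    obtain rfl : β = 1 - α := by linarith
    have e : x + (α • r + (1 - α) • s) • u = α • (x + r • u) + (1 - α) • (x + s • u) := by
      simp only [smul_eq_mul]
      module
    simp only [e]
  have hmono : Monotone fun r : ℝ => g' (x + r • u) u := by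
    have := hconv.monotoneOn_deriv fun r _ => (hd1 r).differentiableAt
    rw [monotoneOn_univ] at this
    rwa [show (deriv fun r : ℝ => g (x + r • u)) = fun r : ℝ => g' (x + r • u) u from
      funext fun r => (hd1 r).deriv] at this
  have h2' : HasFDerivAt g' g'' (x + (0 : ℝ) • u) := by simpa using h2
  have hd2 : HasDerivAt (fun r : ℝ => g' (x + r • u) u) (g'' u u) 0 :=
    (ContinuousLinearMap.apply ℝ ℝ u).hasFDerivAt.comp_hasDerivAt (0 : ℝ)
      (h2'.comp_hasDerivAt (0 : ℝ) (hline 0))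
  rw [← hd2.deriv]
  exact hmono.deriv_nonneg

variable [CompleteSpace E]

/-- The inverse of the Riesz isomorphism of a real Hilbert space as a linear map. -/
def toDualSymmCLM (E : Type*) [NormedAddCommGroup E] [InnerProductSpace ℝ E] [CompleteSpace E] :
    (E →L[ℝ] ℝ) →L[ℝ] E where
  toFun := (InnerProductSpace.toDual ℝ E).symm
  map_add' := map_add _
  map_smul' := by simp
  cont := (InnerProductSpace.toDual ℝ E).symm.continuous

theorem inner_toDualSymmCLM (l : E →L[ℝ] ℝ) (v : E) : ⟪toDualSymmCLM E l, v⟫ = l v :=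
  InnerProductSpace.toDual_symm_apply

theorem hasFDerivAt_gradient_of_contDiff {f : E → ℝ} (hf : ContDiff ℝ 2 f) (x : E) :
    HasFDerivAt (gradient f)
      ((toDualSymmCLM E).comp (fderiv ℝ (fderiv ℝ f) x)) x := by
  have h1 : DifferentiableAt ℝ (fderiv ℝ f) x :=
    (hf.fderiv_right (m := 1) (by norm_num)).differentiable (by norm_num) x
  exact (toDualSymmCLM E).hasFDerivAt.comp x h1.hasFDerivAt

theorem inner_fderiv_gradient {f : E → ℝ} (hf : ContDiff ℝ 2 f) (x u v : E) :
    ⟪fderiv ℝ (gradient f) x u, v⟫ = fderiv ℝ (fderiv ℝ f) x u v := by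
  rw [(hasFDerivAt_gradient_of_contDiff hf x).fderiv]
  exact inner_toDualSymmCLM _ _

theorem inner_fderiv_gradient_nonpos {f : E → ℝ} (hf : ContDiff ℝ 2 f)
    (hconc : ConcaveOn ℝ Set.univ f) (x u : E) : ⟪fderiv ℝ (gradient f) x u, u⟫ ≤ 0 := by
  rw [inner_fderiv_gradient hf]
  have h1 : DifferentiableAt ℝ (fderiv ℝ f) x :=
    (hf.fderiv_right (m := 1) (by norm_num)).differentiable (by norm_num) x
  have := hconc.neg.second_fderiv_nonneg
    (fun z => (hf.differentiable (by norm_num) z).hasFDerivAt.neg) h1.hasFDerivAt.neg u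
  simpa using this

theorem neg_mul_norm_sq_le_inner_fderiv_gradient {f : E → ℝ} (hf : ContDiff ℝ 2 f) {k : ℝ}
    (hconv : ConvexOn ℝ Set.univ fun x => f x + k / 2 * ‖x‖ ^ 2) (x u : E) :
    -k * ‖u‖ ^ 2 ≤ ⟪fderiv ℝ (gradient f) x u, u⟫ := by
  rw [inner_fderiv_gradient hf]
  have h1 : DifferentiableAt ℝ (fderiv ℝ f) x :=
    (hf.fderiv_right (m := 1) (by norm_num)).differentiable (by norm_num) x
  have hsq : ∀ z : E, HasFDerivAt (fun x : E => k / 2 * ‖x‖ ^ 2) (k • realInnerCLM E z) z := by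
    intro z
    refine ((hasStrictFDerivAt_norm_sq z).hasFDerivAt.const_mul (k / 2)).congr_fderiv ?_
    ext v
    simp
    ring
  have := hconv.second_fderiv_nonneg
    (fun z => (hf.differentiable (by norm_num) z).hasFDerivAt.add (hsq z))
    (h1.hasFDerivAt.add ((realInnerCLM E).hasFDerivAt.const_smul k)) u
  simp only [add_apply, smul_apply, smul_eq_mul, realInnerCLM_apply,
    real_inner_self_eq_norm_sq] at this
  linarith

/-- If `f` is concave and `f + k / 2 * ‖·‖ ^ 2` is convex with `1 ≤ k`, then `∇ f + id` is
`k`-Lipschitz. -/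
theorem norm_gradient_add_id_sub_le {f : E → ℝ} (hf : ContDiff ℝ 2 f) {k : ℝ} (hk : 1 ≤ k)
    (hconc : ConcaveOn ℝ Set.univ f)
    (hconv : ConvexOn ℝ Set.univ fun x => f x + k / 2 * ‖x‖ ^ 2) (x y : E) :
    ‖(gradient f x + x) - (gradient f y + y)‖ ≤ k * ‖x - y‖ := by
  have hd : ∀ z, HasFDerivAt (fun z => gradient f z + z)
      (fderiv ℝ (gradient f) z + ContinuousLinearMap.id ℝ E) z := fun z =>
    (hasFDerivAt_gradient_of_contDiff hf z).differentiableAt.hasFDerivAt.add (hasFDerivAt_id z)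
  refine convex_univ.norm_image_sub_le_of_norm_hasFDerivWithin_le
    (fun z _ => (hd z).hasFDerivWithinAt) (fun z _ => ?_) (Set.mem_univ y) (Set.mem_univ x)
  refine ContinuousLinearMap.opNorm_le_bound _ (by linarith) fun u => ?_
  set S := fderiv ℝ (gradient f) z + ContinuousLinearMap.id ℝ E with hS
  have hsymm : ∀ u v, ⟪S u, v⟫ = ⟪S v, u⟫ := by
    intro u v
    have hs : IsSymmSndFDerivAt ℝ f z :=
      hf.contDiffAt.isSymmSndFDerivAt (by simp)
    simp only [hS, add_apply, inner_add_left, inner_fderiv_gradient hf,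
      ContinuousLinearMap.id_apply, hs u v, real_inner_comm u v]
  have hupper : ∀ u, ⟪S u, u⟫ ≤ k * ‖u‖ ^ 2 := by
    intro u
    have h0 := inner_fderiv_gradient_nonpos hf hconc z u
    simp only [hS, add_apply, inner_add_left, ContinuousLinearMap.id_apply,
      real_inner_self_eq_norm_sq]
    nlinarith [sq_nonneg ‖u‖]
  have hlower : ∀ u, -(k * ‖u‖ ^ 2) ≤ ⟪S u, u⟫ := by
    intro u
    have h0 := neg_mul_norm_sq_le_inner_fderiv_gradient hf hconv z u
    simp only [hS, add_apply, inner_add_left, ContinuousLinearMap.id_apply,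
      real_inner_self_eq_norm_sq]
    nlinarith [sq_nonneg ‖u‖]
  have hpol : ∀ u v, 2 * ⟪S u, v⟫ ≤ k * (‖u‖ ^ 2 + ‖v‖ ^ 2) := by
    intro u v
    have h1 := hupper (u + v)
    have h2 := hlower (u - v)
    rw [norm_add_sq_real] at h1
    rw [norm_sub_sq_real] at h2
    simp only [map_add, map_sub, inner_add_left, inner_add_right, inner_sub_left,
      inner_sub_right, hsymm v u] at h1 h2
    linarith
  have hk0 : 0 < k := by linarith
  have h3 := hpol u (k⁻¹ • S u)
  rw [inner_smul_right, real_inner_self_eq_norm_sq, norm_smul, mul_pow, Real.norm_eq_abs,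
    sq_abs] at h3
  refine abs_le_of_sq_le_sq' ?_ (by positivity) |>.2
  have h4 : k * (2 * (k⁻¹ * ‖S u‖ ^ 2)) ≤ k * (k * (‖u‖ ^ 2 + k⁻¹ ^ 2 * ‖S u‖ ^ 2)) :=
    mul_le_mul_of_nonneg_left h3 hk0.le
  field_simp at h4
  nlinarith
end Hessian

section Smoothing
variable {E G : Type*} [NormedAddCommGroup E] [InnerProductSpace ℝ E] [MeasurableSpace E]
  [BorelSpace E] [SecondCountableTopology E] [NormedAddCommGroup G] [NormedSpace ℝ G]

omit [NormedSpace ℝ G] in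
theorem integrable_comp_sub_smul (μ : Measure E) [IsFiniteMeasure μ] (a : ℝ) {Φ : E → G}
    (hΦ : Continuous Φ) {C : ℝ} (hC : ∀ z, ‖Φ z‖ ≤ C) (x : E) :
    Integrable (fun y => Φ (x - a • y)) μ :=
  Integrable.of_bound (by fun_prop : Continuous fun y => Φ (x - a • y)).aestronglyMeasurable C
    (Filter.Eventually.of_forall fun y => hC _)

theorem continuous_integral_comp_sub_smul (μ : Measure E) [IsFiniteMeasure μ] (a : ℝ) {Φ : E → G}
    (hΦ : Continuous Φ) {C : ℝ} (hC : ∀ z, ‖Φ z‖ ≤ C) :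
    Continuous fun x => ∫ y, Φ (x - a • y) ∂μ :=
  continuous_of_dominated (fun x => (integrable_comp_sub_smul μ a hΦ hC x).aestronglyMeasurable)
    (fun x => Filter.Eventually.of_forall fun y => hC _) (integrable_const C)
    (Filter.Eventually.of_forall fun y => by fun_prop)

theorem hasFDerivAt_integral_comp_sub_smul (μ : Measure E) [IsFiniteMeasure μ] (a : ℝ)
    {Φ : E → G} {Φ' : E → E →L[ℝ] G} (hd : ∀ z, HasFDerivAt Φ (Φ' z) z) (hΦ' : Continuous Φ')
    {C C' : ℝ} (hC : ∀ z, ‖Φ z‖ ≤ C) (hC' : ∀ z, ‖Φ' z‖ ≤ C') (x : E) :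
    HasFDerivAt (fun x => ∫ y, Φ (x - a • y) ∂μ) (∫ y, Φ' (x - a • y) ∂μ) x := by
  have hΦ : Continuous Φ := continuous_iff_continuousAt.2 fun z => (hd z).continuousAt
  refine hasFDerivAt_integral_of_dominated_of_fderiv_le (bound := fun _ => C')
    (F' := fun x y => Φ' (x - a • y)) Filter.univ_mem
    (Filter.Eventually.of_forall fun x =>
      (integrable_comp_sub_smul μ a hΦ hC x).aestronglyMeasurable)
    (integrable_comp_sub_smul μ a hΦ hC x)
    (integrable_comp_sub_smul μ a hΦ' hC' x).aestronglyMeasurable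
    (Filter.Eventually.of_forall fun y x _ => hC' _) (integrable_const C')
    (Filter.Eventually.of_forall fun y x _ => ?_)
  exact (hd (x - a • y)).comp x ((hasFDerivAt_id x).sub_const (a • y))

omit [InnerProductSpace ℝ E] [MeasurableSpace E] [BorelSpace E] [SecondCountableTopology E] in
theorem exp_neg_norm_sq_div_mul_le {r : ℝ} (hr : 0 < r) (z : E) :
    Real.exp (-‖z‖ ^ 2 / r) * ‖z‖ ^ 2 ≤ r := by
  have h1 := Real.add_one_le_exp (‖z‖ ^ 2 / r)
  have h2 : ‖z‖ ^ 2 ≤ r * Real.exp (‖z‖ ^ 2 / r) := by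
    have : r * (‖z‖ ^ 2 / r + 1) ≤ r * Real.exp (‖z‖ ^ 2 / r) :=
      mul_le_mul_of_nonneg_left h1 hr.le
    have e : r * (‖z‖ ^ 2 / r + 1) = ‖z‖ ^ 2 + r := by field_simp
    linarith
  rw [neg_div, Real.exp_neg, inv_mul_le_iff₀ (Real.exp_pos _), mul_comm]
  exact h2

omit [InnerProductSpace ℝ E] [MeasurableSpace E] [BorelSpace E] [SecondCountableTopology E] in
theorem exp_neg_norm_sq_div_le_one {r : ℝ} (hr : 0 < r) (z : E) :
    Real.exp (-‖z‖ ^ 2 / r) ≤ 1 :=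
  Real.exp_le_one_iff.2 (div_nonpos_of_nonpos_of_nonneg (by simp) hr.le)

/-- Convolution of a finite measure with a Gaussian kernel is twice continuously differentiable. -/
theorem contDiff_integral_exp_neg_norm_sq (μ : Measure E) [IsFiniteMeasure μ] (a : ℝ) {r : ℝ}
    (hr : 0 < r) : ContDiff ℝ 2 fun x => ∫ y, Real.exp (-‖x - a • y‖ ^ 2 / r) ∂μ := by
  set φ : E → ℝ := fun z => Real.exp (-‖z‖ ^ 2 / r) with hφ
  set φ' : E → E →L[ℝ] ℝ := fun z => (-2 / r * φ z) • realInnerCLM E z with hφ'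
  set φ'' : E → E →L[ℝ] E →L[ℝ] ℝ := fun z =>
    (-2 / r * φ z) • (realInnerCLM E) +
      ((-2 / r) • φ' z).smulRight (realInnerCLM E z) with hφ''
  have hφ0 : ∀ z, 0 ≤ φ z := fun z => (Real.exp_pos _).le
  have hφ1 : ∀ z, φ z ≤ 1 := exp_neg_norm_sq_div_le_one hr
  have hφ2 : ∀ z, φ z * ‖z‖ ^ 2 ≤ r := exp_neg_norm_sq_div_mul_le hr
  have hφc : Continuous φ := by fun_prop
  have hφ'c : Continuous φ' := by fun_prop
  have hφ''c : Continuous φ'' := by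
    have h1 : Continuous fun z => (ContinuousLinearMap.smulRightL ℝ E (E →L[ℝ] ℝ))
        ((-2 / r) • φ' z) (realInnerCLM E z) := by fun_prop
    exact (((continuous_const.mul hφc).smul continuous_const).add h1)
  have hd1 : ∀ z, HasFDerivAt φ (φ' z) z := by
    intro z
    have h1 := ((hasStrictFDerivAt_norm_sq z).hasFDerivAt.const_mul (-1 / r)).exp
    convert h1 using 1
    · ext w
      simp only [hφ]
      congr 1
      ring
    · ext w
      simp [hφ', hφ, innerSL_apply_apply]
      ring_nf
  have hd2 : ∀ z, HasFDerivAt φ' (φ'' z) z := by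
    intro z
    exact ((hd1 z).const_mul (-2 / r)).smul (realInnerCLM E).hasFDerivAt
  have hb0 : ∀ z, ‖φ z‖ ≤ 1 := fun z => by rw [Real.norm_of_nonneg (hφ0 z)]; exact hφ1 z
  have hr' : ‖(-2 / r : ℝ)‖ = 2 / r := by
    rw [norm_div, norm_neg, Real.norm_of_nonneg hr.le]; norm_num
  have hn : ∀ z, ‖φ' z‖ ≤ 2 / r * (φ z * ‖z‖) := by
    intro z
    rw [hφ', norm_smul, norm_mul, Real.norm_of_nonneg (hφ0 z), hr', mul_assoc]
    gcongr
    exact norm_realInnerCLM_apply_le z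
  have hb1 : ∀ z, ‖φ' z‖ ≤ 2 / r * (1 + r) := by
    intro z
    refine (hn z).trans (mul_le_mul_of_nonneg_left ?_ (by positivity))
    nlinarith [hφ0 z, hφ1 z, hφ2 z, mul_nonneg (hφ0 z) (sq_nonneg (‖z‖ - 1)),
      mul_nonneg (hφ0 z) (sq_nonneg ‖z‖)]
  have hb2 : ∀ z, ‖φ'' z‖ ≤ 2 / r + 2 / r * (2 / r * r) := by
    intro z
    refine ContinuousLinearMap.opNorm_le_bound _ (by positivity) fun w => ?_
    have e : φ'' z w = (-2 / r * φ z) • realInnerCLM E w +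
        (-2 / r * φ' z w) • realInnerCLM E z := rfl
    have h1 : ‖φ' z w‖ ≤ 2 / r * (φ z * ‖z‖) * ‖w‖ := (φ' z).le_of_opNorm_le (hn z) w
    rw [e, add_mul]
    refine (norm_add_le _ _).trans (add_le_add ?_ ?_)
    · rw [norm_smul, norm_mul, hr', Real.norm_of_nonneg (hφ0 z)]
      calc 2 / r * φ z * ‖realInnerCLM E w‖ ≤ 2 / r * 1 * ‖w‖ := by
            gcongr
            · exact hφ1 z
            · exact norm_realInnerCLM_apply_le w
        _ = 2 / r * ‖w‖ := by rw [mul_one]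
    · rw [norm_smul, norm_mul, hr']
      calc 2 / r * ‖φ' z w‖ * ‖realInnerCLM E z‖
          ≤ 2 / r * (2 / r * (φ z * ‖z‖) * ‖w‖) * ‖z‖ := by
            gcongr
            exact norm_realInnerCLM_apply_le z
        _ = 2 / r * (2 / r * (φ z * ‖z‖ ^ 2)) * ‖w‖ := by ring
        _ ≤ 2 / r * (2 / r * r) * ‖w‖ := by gcongr; exact hφ2 z
  have H1 := hasFDerivAt_integral_comp_sub_smul μ a hd1 hφ'c hb0 hb1
  have H2 := hasFDerivAt_integral_comp_sub_smul μ a hd2 hφ''c hb1 hb2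
  have H3 := continuous_integral_comp_sub_smul (G := E →L[ℝ] E →L[ℝ] ℝ) μ a hφ''c hb2
  have C1 : ContDiff ℝ 1 fun x => ∫ y, φ' (x - a • y) ∂μ :=
    contDiff_one_iff_hasFDerivAt.2 ⟨_, H3, H2⟩
  exact (contDiff_succ_iff_hasFDerivAt (n := 1)).2 ⟨_, C1, H1⟩
end Smoothing

section LogConcavity

theorem add_log_le_log_of_ofReal {α β p q s : ℝ} (hp : 0 < p) (hq : 0 < q) (hs : 0 < s)
    (h : ENNReal.ofReal p ^ α * ENNReal.ofReal q ^ β ≤ ENNReal.ofReal s) :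
    α * Real.log p + β * Real.log q ≤ Real.log s := by
  rw [ENNReal.ofReal_rpow_of_pos hp, ENNReal.ofReal_rpow_of_pos hq,
    ← ENNReal.ofReal_mul (by positivity), ENNReal.ofReal_le_ofReal_iff hs.le] at h
  have := Real.log_le_log (by positivity) h
  rwa [Real.log_mul (by positivity) (by positivity), Real.log_rpow hp, Real.log_rpow hq] at this

theorem log_le_add_log_of_ofReal {α β c p q s : ℝ} (hp : 0 < p) (hq : 0 < q) (hs : 0 < s)
    (h : ENNReal.ofReal s ≤
      ENNReal.ofReal (Real.exp c) * (ENNReal.ofReal p ^ α * ENNReal.ofReal q ^ β)) :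
    Real.log s ≤ c + (α * Real.log p + β * Real.log q) := by
  rw [ENNReal.ofReal_rpow_of_pos hp, ENNReal.ofReal_rpow_of_pos hq,
    ← ENNReal.ofReal_mul (by positivity), ← ENNReal.ofReal_mul (by positivity),
    ENNReal.ofReal_le_ofReal_iff (by positivity)] at h
  have := Real.log_le_log hs h
  rwa [Real.log_mul (by positivity) (by positivity), Real.log_exp,
    Real.log_mul (by positivity) (by positivity), Real.log_rpow hp, Real.log_rpow hq] at this

theorem ofReal_exp_rpow_mul_rpow (α β u v : ℝ) :
    ENNReal.ofReal (Real.exp u) ^ α * ENNReal.ofReal (Real.exp v) ^ β =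
      ENNReal.ofReal (Real.exp (α * u + β * v)) := by
  rw [ENNReal.ofReal_rpow_of_pos (Real.exp_pos _), ENNReal.ofReal_rpow_of_pos (Real.exp_pos _),
    ← ENNReal.ofReal_mul (by positivity), ← Real.exp_mul, ← Real.exp_mul, ← Real.exp_add,
    mul_comm u, mul_comm v]

section Kernel
variable {E : Type*} [NormedAddCommGroup E] [InnerProductSpace ℝ E] [MeasurableSpace E]
  [BorelSpace E] [SecondCountableTopology E]

theorem integrable_exp_neg_norm_sq (μ : Measure E) [IsFiniteMeasure μ] (a : ℝ) {r : ℝ}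
    (hr : 0 < r) (x : E) : Integrable (fun y => Real.exp (-‖x - a • y‖ ^ 2 / r)) μ :=
  integrable_comp_sub_smul (Φ := fun z => Real.exp (-‖z‖ ^ 2 / r)) μ a (by fun_prop) (C := 1)
    (fun z => by
      rw [Real.norm_of_nonneg (Real.exp_pos _).le]
      exact exp_neg_norm_sq_div_le_one hr z) x

theorem ofReal_integral_exp_neg_norm_sq (μ : Measure E) [IsFiniteMeasure μ] (a : ℝ) {r : ℝ}
    (hr : 0 < r) (x : E) :
    ENNReal.ofReal (∫ y, Real.exp (-‖x - a • y‖ ^ 2 / r) ∂μ) =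
      ∫⁻ y, ENNReal.ofReal (Real.exp (-‖x - a • y‖ ^ 2 / r)) ∂μ :=
  ofReal_integral_eq_lintegral_ofReal (integrable_exp_neg_norm_sq μ a hr x)
    (Filter.Eventually.of_forall fun _ => (Real.exp_pos _).le)

theorem convexOn_log_integral_add_norm_sq (μ : Measure E) [IsFiniteMeasure μ] [NeZero μ] (a : ℝ)
    {r : ℝ} (hr : 0 < r) :
    ConvexOn ℝ Set.univ fun x =>
      Real.log (∫ y, Real.exp (-‖x - a • y‖ ^ 2 / r) ∂μ) + ‖x‖ ^ 2 / r := by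
  have hpos : ∀ x, 0 < ∫ y, Real.exp (-‖x - a • y‖ ^ 2 / r) ∂μ := fun x =>
    integral_exp_pos (integrable_exp_neg_norm_sq μ a hr x)
  refine convexOn_iff_forall_pos.2 ⟨convex_univ, fun x _ y _ α β hα hβ hαβ => ?_⟩
  have key := log_le_add_log_of_ofReal (α := α) (β := β) (c := α * β * ‖x - y‖ ^ 2 / r)
    (hpos x) (hpos y) (hpos (α • x + β • y)) (by
      simp only [ofReal_integral_exp_neg_norm_sq μ a hr]
      have meas : ∀ x : E, AEMeasurable
          (fun w => ENNReal.ofReal (Real.exp (-‖x - a • w‖ ^ 2 / r))) μ := fun x => by fun_prop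
      refine le_trans (le_of_eq ?_) (mul_le_mul_right
        (ENNReal.lintegral_mul_norm_pow_le (meas x) (meas y) hα.le hβ.le hαβ) _)
      rw [← lintegral_const_mul' _ _ ENNReal.ofReal_ne_top]
      refine lintegral_congr fun w => ?_
      rw [ofReal_exp_rpow_mul_rpow, ← ENNReal.ofReal_mul (Real.exp_pos _).le, ← Real.exp_add]
      have e1 : α • x + β • y - a • w = α • (x - a • w) + β • (y - a • w) := by
        obtain rfl : β = 1 - α := by linarith
        module
      rw [e1, norm_sq_convex_combination hαβ, sub_sub_sub_cancel_right]
      congr 2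
      ring)
  rw [norm_sq_convex_combination hαβ]
  simp only [smul_eq_mul]
  refine (add_le_add_left key _).trans (le_of_eq ?_)
  ring

end Kernel

/-- Gaussian smoothing preserves log-concavity. -/
theorem concaveOn_log_integral_of_logConcave {d : ℕ} {V : Euc d → ℝ}
    (hV : ConvexOn ℝ Set.univ V) (hVm : Measurable V) {c : ℝ≥0∞} {μ : Measure (Euc d)}
    (hμ : μ = c • volume.withDensity fun x => ENNReal.ofReal (Real.exp (-V x)))
    (hc0 : c ≠ 0) (hc : c ≠ ∞)
    [IsFiniteMeasure μ] [NeZero μ] (a : ℝ) {r : ℝ} (hr : 0 < r) :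
    ConcaveOn ℝ Set.univ fun x => Real.log (∫ y, Real.exp (-‖x - a • y‖ ^ 2 / r) ∂μ) := by
  have hpos : ∀ x, 0 < ∫ y, Real.exp (-‖x - a • y‖ ^ 2 / r) ∂μ := fun x =>
    integral_exp_pos (integrable_exp_neg_norm_sq μ a hr x)
  refine concaveOn_iff_forall_pos.2 ⟨convex_univ, fun x _ y _ α β hα hβ hαβ => ?_⟩
  refine add_log_le_log_of_ofReal (hpos x) (hpos y) (hpos _) ?_
  have hint : ∀ x : Euc d, ENNReal.ofReal (∫ y, Real.exp (-‖x - a • y‖ ^ 2 / r) ∂μ) =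
      c * ∫⁻ w, ENNReal.ofReal (Real.exp (-‖x - a • w‖ ^ 2 / r - V w)) := by
    intro x
    rw [ofReal_integral_exp_neg_norm_sq μ a hr, hμ, lintegral_smul_measure,
      lintegral_withDensity_eq_lintegral_mul _ (by fun_prop) (by fun_prop), smul_eq_mul]
    congr 1
    refine lintegral_congr fun w => ?_
    rw [Pi.mul_apply, ← ENNReal.ofReal_mul (Real.exp_pos _).le, ← Real.exp_add, neg_add_eq_sub]
  rw [hint, hint, hint, ENNReal.mul_rpow_of_nonneg _ _ hα.le, ENNReal.mul_rpow_of_nonneg _ _ hβ.le,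
    mul_mul_mul_comm, ← ENNReal.rpow_add _ _ hc0 hc, hαβ, ENNReal.rpow_one]
  refine mul_le_mul_right (prekopa_leindler hα hβ hαβ (by fun_prop) (by fun_prop) (by fun_prop)
    fun w z => ?_) _
  rw [ofReal_exp_rpow_mul_rpow]
  refine ENNReal.ofReal_le_ofReal (Real.exp_le_exp.2 ?_)
  have h1 := hV.2 (Set.mem_univ w) (Set.mem_univ z) hα.le hβ.le hαβ
  have e1 : α • x + β • y - a • (α • w + β • z) = α • (x - a • w) + β • (y - a • z) := by
    module
  have h2 : ‖α • x + β • y - a • (α • w + β • z)‖ ^ 2 / r ≤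
      (α * ‖x - a • w‖ ^ 2 + β * ‖y - a • z‖ ^ 2) / r := by
    rw [e1, norm_sq_convex_combination hαβ]
    gcongr
    have : 0 ≤ α * β * ‖x - a • w - (y - a • z)‖ ^ 2 := by positivity
    linarith
  simp only [smul_eq_mul] at h1
  have e2 : α * (-‖x - a • w‖ ^ 2 / r - V w) + β * (-‖y - a • z‖ ^ 2 / r - V z) =
      -((α * ‖x - a • w‖ ^ 2 + β * ‖y - a • z‖ ^ 2) / r) - (α * V w + β * V z) := by ring
  rw [e2, neg_div]
  linarith

end LogConcavity

/-- log-concave data. If `V : ℝ^d → ℝ` is convex, `C²`, with `e^{−V}`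
integrable, and `μ ∝ e^{−V}`, then for every `t > 0` and `x`,
`−(1/(1−e^{−2t})) I ⪯ ∇²log p_t(x) ⪯ 0` (as quadratic forms), and consequently the relative
score `x ↦ ∇log p_t(x) + x` is `1/(1−e^{−2t})`-Lipschitz. -/
theorem statement_9 (d : ℕ) (hd : 1 ≤ d)
    (V : Euc d → ℝ) (hVconv : ConvexOn ℝ Set.univ V) (hVsmooth : ContDiff ℝ 2 V)
    (hVint : Integrable (fun x => Real.exp (-V x)) (volume : Measure (Euc d)))
    (μ : Measure (Euc d))
    (hμ : μ = (ENNReal.ofReal (∫ x, Real.exp (-V x)))⁻¹ •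
        volume.withDensity fun x => ENNReal.ofReal (Real.exp (-V x)))
    (t : ℝ) (ht : 0 < t) :
    (∀ x u : Euc d,
      -(1 / (1 - Real.exp (-2 * t))) * ‖u‖ ^ 2 ≤
          ⟪(fderiv ℝ (fun z => gradient (fun w => Real.log (ouDensity d μ t w)) z) x) u, u⟫ ∧
      ⟪(fderiv ℝ (fun z => gradient (fun w => Real.log (ouDensity d μ t w)) z) x) u, u⟫ ≤ 0) ∧
    (∀ x y : Euc d,
      ‖relScore d μ t x - relScore d μ t y‖ ≤ (1 / (1 - Real.exp (-2 * t))) * ‖x - y‖) := by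
  have hexp : Real.exp (-2 * t) < 1 := by
    simpa using ht
  have hs : 0 < 1 - Real.exp (-2 * t) := by linarith
  have hr : 0 < 2 * (1 - Real.exp (-2 * t)) := by linarith
  have hZ : 0 < ∫ x, Real.exp (-V x) := integral_exp_pos hVint
  have hZ0 : ENNReal.ofReal (∫ x, Real.exp (-V x)) ≠ 0 := (ENNReal.ofReal_pos.2 hZ).ne'
  have hprob : IsProbabilityMeasure μ := by
    constructor
    rw [hμ, Measure.smul_apply, withDensity_apply _ MeasurableSet.univ, Measure.restrict_univ,
      ← ofReal_integral_eq_lintegral_ofReal hVint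
        (Filter.Eventually.of_forall fun _ => (Real.exp_pos _).le), smul_eq_mul]
    exact ENNReal.inv_mul_cancel hZ0 ENNReal.ofReal_ne_top
  set q : Euc d → ℝ := fun x =>
    ∫ y, Real.exp (-‖x - Real.exp (-t) • y‖ ^ 2 / (2 * (1 - Real.exp (-2 * t)))) ∂μ with hq
  have hqpos : ∀ x, 0 < q x := fun x => integral_exp_pos (integrable_exp_neg_norm_sq μ _ hr x)
  have hCpos : 0 < (2 * π * (1 - Real.exp (-2 * t))) ^ (-(d : ℝ) / 2) :=
    Real.rpow_pos_of_pos (by positivity) _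
  have hlog : (fun w => Real.log (ouDensity d μ t w)) = fun w =>
      Real.log (q w) + Real.log ((2 * π * (1 - Real.exp (-2 * t))) ^ (-(d : ℝ) / 2)) := by
    funext w
    rw [add_comm]
    exact Real.log_mul hCpos.ne' (hqpos w).ne'
  have hsmooth : ContDiff ℝ 2 fun w => Real.log (ouDensity d μ t w) := by
    rw [hlog]
    exact ((contDiff_integral_exp_neg_norm_sq μ _ hr).log fun x => (hqpos x).ne').add contDiff_const
  have hconc : ConcaveOn ℝ Set.univ fun w => Real.log (ouDensity d μ t w) := by
    rw [hlog]
    exact (concaveOn_log_integral_of_logConcave hVconv hVsmooth.continuous.measurable hμ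
      (ENNReal.inv_ne_zero.2 ENNReal.ofReal_ne_top) (ENNReal.inv_ne_top.2 hZ0) _ hr).add_const _
  have hconv : ConvexOn ℝ Set.univ fun w => Real.log (ouDensity d μ t w) +
      (1 / (1 - Real.exp (-2 * t))) / 2 * ‖w‖ ^ 2 := by
    have h1 := (convexOn_log_integral_add_norm_sq μ (Real.exp (-t)) hr).add_const
      (Real.log ((2 * π * (1 - Real.exp (-2 * t))) ^ (-(d : ℝ) / 2)))
    refine h1.congr fun w _ => ?_
    have hw := congrFun hlog w
    simp only [hq] at hw
    simp only [Pi.add_apply]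
    rw [hw, div_div, one_div_mul_eq_div, mul_comm (1 - Real.exp (-2 * t)) 2]
    ring
  refine ⟨fun x u => ⟨neg_mul_norm_sq_le_inner_fderiv_gradient hsmooth hconv x u,
    inner_fderiv_gradient_nonpos hsmooth hconc x u⟩, fun x y => ?_⟩
  refine norm_gradient_add_id_sub_le hsmooth ?_ hconc hconv x y
  rw [le_div_iff₀ hs]
  linarith [Real.exp_pos (-2 * t)]
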